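/- Let λ = ∑_{i=1}^{∞} p^{k_i} ∈ ℚ_p. Then λ is not a rational integer (in particular λ − i ≠ 0 for every natural number i), and for every natural number r the sequence i ↦ p^{ri}/(λ − i) does NOT tend to 0 in ℚ_p as i → ∞. That is, λ has type zero in the sense of Kedlaya. -/

import Mathlib

theorem Padic.norm_tsum_p_pow_sub_sum_range (p : ℕ) [Fact p.Prime] {a : ℕ → ℕ}
    (ha : StrictMono a) (n : ℕ) :
    ‖(∑' i : ℕ, (p : ℚ_[p]) ^ a i) - ∑ i ∈ Finset.range n, (p : ℚ_[p]) ^ a i‖ =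
      (p : ℝ) ^ (-(a n : ℤ)) := by
  have hp : (1 : ℝ) < p := mod_cast (Fact.out : p.Prime).one_lt
  have hsum : Summable fun i : ℕ => (p : ℚ_[p]) ^ a i := by
    have hgeom : Summable fun i : ℕ => (p : ℚ_[p]) ^ i :=
      summable_geometric_of_norm_lt_one Padic.norm_p_lt_one
    exact hgeom.comp_injective ha.injective
  have htail : ∀ m, ‖(∑' i : ℕ, (p : ℚ_[p]) ^ a i) - ∑ i ∈ Finset.range m, (p : ℚ_[p]) ^ a i‖ ≤
      (p : ℝ) ^ (-(a m : ℤ)) := by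
    intro m
    rw [← hsum.sum_add_tsum_nat_add m, add_sub_cancel_left]
    refine IsUltrametricDist.norm_tsum_le_of_forall_le_of_nonneg (by positivity) fun i => ?_
    rw [Padic.norm_p_pow]
    exact zpow_le_zpow_right₀ hp.le (by have := ha.monotone (Nat.le_add_left m i); omega)
  have hlt : ‖(∑' i : ℕ, (p : ℚ_[p]) ^ a i) - ∑ i ∈ Finset.range (n + 1), (p : ℚ_[p]) ^ a i‖ <
      ‖(p : ℚ_[p]) ^ a n‖ := by
    refine (htail (n + 1)).trans_lt ?_
    rw [Padic.norm_p_pow]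
    exact zpow_lt_zpow_right₀ hp (by have := ha (Nat.lt_add_one n); omega)
  have hsplit : (∑' i : ℕ, (p : ℚ_[p]) ^ a i) - ∑ i ∈ Finset.range n, (p : ℚ_[p]) ^ a i =
      ((∑' i : ℕ, (p : ℚ_[p]) ^ a i) - ∑ i ∈ Finset.range (n + 1), (p : ℚ_[p]) ^ a i) +
        (p : ℚ_[p]) ^ a n := by
    rw [Finset.sum_range_succ]; ring
  rw [hsplit, IsUltrametricDist.norm_add_eq_max_of_norm_ne_norm hlt.ne, max_eq_right hlt.le,
    Padic.norm_p_pow]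

theorem Nat.sum_range_pow_lt_pow {b : ℕ} (hb : 2 ≤ b) {a : ℕ → ℕ} (ha : StrictMono a) (n : ℕ) :
    ∑ i ∈ Finset.range n, b ^ a i < b ^ a n := by
  rw [← Finset.sum_image (f := fun j => b ^ j) ha.injective.injOn]
  refine Nat.geomSum_lt hb fun j hj => ?_
  obtain ⟨i, hi, rfl⟩ := Finset.mem_image.1 hj
  exact ha (Finset.mem_range.1 hi)

/-- Let `p` be prime, `k₁ = p` and `k_{n+1} = p^(2 k_n)` for `n ≥ 1`, and let
`λ = ∑_{i=1}^{∞} p^(k_i) ∈ ℚ_p`. Then `λ` is not a rational integer (in particular `λ - i ≠ 0`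
for every natural number `i`), and for every natural number `r` the sequence
`i ↦ p^(r i)/(λ - i)` does NOT tend to `0` in `ℚ_p`; that is, `λ` has type zero in the sense
of Kedlaya. -/
theorem lebras_example_kedlaya_type_zero
    (p : ℕ) [Fact p.Prime] (k : ℕ → ℕ) (hk1 : k 1 = p)
    (hkrec : ∀ n : ℕ, 1 ≤ n → k (n + 1) = p ^ (2 * k n)) :
    (∀ m : ℤ, (∑' i : ℕ, (p : ℚ_[p]) ^ k (i + 1)) ≠ (m : ℚ_[p])) ∧
    ∀ r : ℕ, ¬ Filter.Tendsto
      (fun i : ℕ => (p : ℚ_[p]) ^ (r * i) /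
        ((∑' i : ℕ, (p : ℚ_[p]) ^ k (i + 1)) - (i : ℚ_[p])))
      Filter.atTop (nhds 0) := by
  have hp : 2 ≤ p := (Fact.out : p.Prime).two_le
  obtain ⟨a, ha⟩ : ∃ a : ℕ → ℕ, ∀ i, k (i + 1) = a i := ⟨fun i => k (i + 1), fun _ => rfl⟩
  have hrec : ∀ n, a (n + 1) = p ^ (2 * a n) := fun n => by
    rw [← ha, ← ha, hkrec _ n.succ_pos]
  have hmono : StrictMono a := strictMono_nat_of_lt_succ fun n => by
    rw [hrec]
    have := Nat.lt_pow_self (n := 2 * a n) (show 1 < p by omega)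
    omega
  have hge : ∀ n, n < p ^ a n := fun n =>
    (hmono.le_apply).trans_lt (Nat.lt_pow_self (show 1 < p by omega))
  have hS : ∀ n, ∑ i ∈ Finset.range (n + 1), p ^ a i < 2 * p ^ a n := fun n => by
    rw [Finset.sum_range_succ]
    have := Nat.sum_range_pow_lt_pow hp hmono n
    omega
  have hnorm := Padic.norm_tsum_p_pow_sub_sum_range p hmono
  simp only [ha]
  refine ⟨fun m hm => ?_, fun r hr => ?_⟩
  · obtain ⟨n, hmn⟩ : ∃ n, m.natAbs + 2 = n := ⟨_, rfl⟩
    have hn := hnorm (n + 1)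
    have hcast : (m : ℚ_[p]) - ∑ i ∈ Finset.range (n + 1), (p : ℚ_[p]) ^ a i =
        ((m - (∑ i ∈ Finset.range (n + 1), p ^ a i : ℕ) : ℤ) : ℚ_[p]) := by
      push_cast; rfl
    rw [hm, hcast] at hn
    have hdvd := (Padic.norm_int_le_pow_iff_dvd _ _).1 hn.le
    have hne : m - (∑ i ∈ Finset.range (n + 1), p ^ a i : ℕ) ≠ 0 := by
      intro h
      rw [h, Int.cast_zero, norm_zero] at hn
      exact (zpow_pos (show (0 : ℝ) < p by positivity) _).ne hn
    have hle := Nat.le_of_dvd (Int.natAbs_pos.2 hne) (Int.natCast_dvd.1 (mod_cast hdvd))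
    have hbig : 2 * (p ^ a n * p ^ a n) ≤ p ^ a (n + 1) := by
      calc 2 * (p ^ a n * p ^ a n) ≤ p * (p ^ a n * p ^ a n) := by gcongr
        _ = p ^ (2 * a n + 1) := by ring
        _ ≤ p ^ a (n + 1) := by
          rw [hrec n]
          exact Nat.pow_le_pow_right (by omega) (Nat.lt_pow_self (show 1 < p by omega))
    have hSn := hS n
    have hgen := hge n
    have : m.natAbs + 2 * p ^ a n < 2 * (p ^ a n * p ^ a n) := by nlinarith
    omega
  · have hS_tendsto : Filter.Tendsto (fun n => ∑ i ∈ Finset.range (n + 1), p ^ a i)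
        Filter.atTop Filter.atTop := by
      refine Filter.tendsto_atTop_mono (fun n => ?_) Filter.tendsto_id
      exact (hge n).le.trans (Finset.single_le_sum (f := fun i => p ^ a i)
        (fun _ _ => Nat.zero_le _) (Finset.self_mem_range_succ n))
    have hlt := (hr.comp hS_tendsto).norm.eventually_lt_const
      (show ‖(0 : ℚ_[p])‖ < 1 by simp)
    obtain ⟨n, hn, hrn⟩ := (hlt.and (Filter.eventually_ge_atTop (2 * r))).exists
    refine hn.not_ge ?_
    simp only [Function.comp_apply, Nat.cast_sum, Nat.cast_pow, norm_div, hnorm, Padic.norm_p_pow]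
    have hp1 : (1 : ℝ) ≤ p := by exact_mod_cast (show 1 ≤ p by omega)
    rw [one_le_div (by positivity)]
    refine zpow_le_zpow_right₀ hp1 (neg_le_neg (Nat.cast_le.2 ?_))
    calc r * ∑ i ∈ Finset.range (n + 1), p ^ a i ≤ r * (2 * p ^ a n) := by gcongr; exact (hS n).le
      _ = 2 * r * p ^ a n := by ring
      _ ≤ p ^ a n * p ^ a n := by gcongr; exact hrn.trans (hge n).le
      _ = a (n + 1) := by rw [hrec]; ring
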